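/- arXiv:1607.06177 — 2 statements merged into one kernel-verified Lean document; each statement's English description precedes it below -/
import Mathlib

section
/- Let V be a C¹ vector field on a connected open set 𝒰 ⊆ ℝⁿ, let Ω ⊆ 𝒰 be a connected open set, let (A_k) be a null sequence of diffusion matrices on 𝒰, and for each k let μ_k be a Borel probability measure on Ω that is a stationary measure for ℒ_{A_k} on Ω, with μ_k → μ weak*. Suppose there exists an open set Ω̃ whose closure is compact and contained in Ω, which is positively invariant under V (V generates a positive semiflow φ : [0,∞) × Ω̃ → Ω̃), and which contains the support of μ. Then μ is an invariant measure of φ, i.e. μ(φ(t,·)⁻¹(B)) = μ(B) for every Borel B ⊆ Ω̃ and every t ≥ 0, and moreover the support of μ is contained in the ω-limit set ω(Ω̃) = ∩_{τ≥0} closure(∪_{t≥τ} φ(t, Ω̃)). -/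
open MeasureTheory Set Filter Topology

noncomputable section

/-- Euclidean `n`-space. -/
abbrev En (n : ℕ) := EuclideanSpace ℝ (Fin n)

/-- The adjoint Fokker–Planck operator
`ℒ_A f(x) = ∑ᵢⱼ aⁱʲ(x) ∂²f/∂xᵢ∂xⱼ(x) + ∑ᵢ Vⁱ(x) ∂f/∂xᵢ(x)`. -/
noncomputable def adjFP {n : ℕ} (A : En n → Matrix (Fin n) (Fin n) ℝ) (V : En n → En n)
    (f : En n → ℝ) (x : En n) : ℝ :=
  (∑ i, ∑ j, A x i j *
      iteratedFDeriv ℝ 2 f x ![EuclideanSpace.single i (1 : ℝ), EuclideanSpace.single j (1 : ℝ)])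
    + fderiv ℝ f x (V x)
/-- A Borel probability measure concentrated on `Ω`. -/
def IsProbOn {n : ℕ} (Ω : Set (En n)) (μ : Measure (En n)) : Prop :=
  IsProbabilityMeasure μ ∧ μ Ωᶜ = 0
/-- `μ` is a stationary measure for `ℒ_A` on `Ω`: it is a Borel probability measure on `Ω`
and `∫_Ω ℒ_A f dμ = 0` for every smooth `f` with compact support contained in `Ω`. -/
def IsStationaryMeasure {n : ℕ} (A : En n → Matrix (Fin n) (Fin n) ℝ) (V : En n → En n)
    (Ω : Set (En n)) (μ : Measure (En n)) : Prop :=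
  IsProbOn Ω μ ∧
  ∀ f : En n → ℝ, ContDiff ℝ (⊤ : ℕ∞) f → HasCompactSupport f → tsupport f ⊆ Ω →
    ∫ x in Ω, adjFP A V f x ∂μ = 0
/-- A null sequence of diffusion matrices on `𝒰`: continuous maps into the symmetric
positive-definite matrices converging to `0` uniformly on every compact subset of `𝒰`. -/
def IsNullSeq {n : ℕ} (𝒰 : Set (En n)) (A : ℕ → En n → Matrix (Fin n) (Fin n) ℝ) : Prop :=
  (∀ k, ContinuousOn (A k) 𝒰) ∧
  (∀ k, ∀ x ∈ 𝒰, (A k x).PosDef) ∧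
  (∀ K : Set (En n), K ⊆ 𝒰 → IsCompact K →
    ∀ ε > 0, ∃ N, ∀ k ≥ N, ∀ x ∈ K, ∀ i j, |A k x i j| ≤ ε)
/-- Weak* convergence `μs → μ` of Borel probability measures on `Ω`: the integrals of every
bounded continuous function on `Ω` converge. -/
def WeakStarLimOn {n : ℕ} (Ω : Set (En n)) (μs : ℕ → Measure (En n))
    (μ : Measure (En n)) : Prop :=
  ∀ f : En n → ℝ, ContinuousOn f Ω → (∃ C, ∀ x ∈ Ω, |f x| ≤ C) →
    Tendsto (fun k => ∫ x in Ω, f x ∂μs k) atTop (𝓝 (∫ x in Ω, f x ∂μ))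
/-- The support of a Borel measure: points all of whose open neighborhoods have
positive measure. -/
def measSupp {n : ℕ} (μ : Measure (En n)) : Set (En n) :=
  {x | ∀ s : Set (En n), IsOpen s → x ∈ s → 0 < μ s}
/-- The positive semiflow generated by `V` on a positively invariant set `Ω`. -/
def IsSemiflowOn {n : ℕ} (V : En n → En n) (Ω : Set (En n)) (φ : ℝ → En n → En n) : Prop :=
  ContinuousOn (fun p : ℝ × En n => φ p.1 p.2) (Ici (0 : ℝ) ×ˢ Ω) ∧
  (∀ t : ℝ, 0 ≤ t → ∀ x ∈ Ω, φ t x ∈ Ω) ∧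
  (∀ x ∈ Ω, φ 0 x = x) ∧
  (∀ t s : ℝ, 0 ≤ t → 0 ≤ s → ∀ x ∈ Ω, φ (t + s) x = φ t (φ s x)) ∧
  (∀ x ∈ Ω, ∀ t : ℝ, 0 ≤ t →
    HasDerivWithinAt (fun τ => φ τ x) (V (φ t x)) (Ici 0) t)
/-- `μ` is a positively invariant measure of the semiflow `φ` on `Ω`:
`μ(φ(t,·)⁻¹(B)) = μ(B)` for every Borel `B ⊆ Ω` and every `t ≥ 0`. -/
def IsPosInvariantUnder {n : ℕ} (Ω : Set (En n)) (φ : ℝ → En n → En n)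
    (μ : Measure (En n)) : Prop :=
  ∀ t : ℝ, 0 ≤ t → ∀ B : Set (En n), B ⊆ Ω → MeasurableSet B → μ (Ω ∩ φ t ⁻¹' B) = μ B


lemma smul_avg {n : ℕ} (ρ : ContDiffBump (0 : En n)) (u : En n → ℝ) (hu : Continuous u)
    (x p : En n) (c ε : ℝ)
    (h : ∀ z ∈ Metric.ball x ρ.rOut, |u (z + p) - u z - c| ≤ ε) :
    |(convolution (ρ.normed volume) u (ContinuousLinearMap.lsmul ℝ ℝ) volume) (x + p)
      - (convolution (ρ.normed volume) u (ContinuousLinearMap.lsmul ℝ ℝ) volume) x - c| ≤ ε := by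
  have hint : ∀ a : En n, Integrable (fun t => ρ.normed volume t * u (a - t)) volume := by
    intro a
    apply Continuous.integrable_of_hasCompactSupport
    · exact ρ.continuous_normed.mul (by fun_prop)
    · exact ρ.hasCompactSupport_normed.mul_right
  have hρ : Integrable (ρ.normed (volume : Measure (En n))) := ρ.integrable_normed
  have h1 : ∫ t, ρ.normed (volume : Measure (En n)) t = 1 := ρ.integral_normed
  have e : (convolution (ρ.normed volume) u (ContinuousLinearMap.lsmul ℝ ℝ) volume) (x + p)
      - (convolution (ρ.normed volume) u (ContinuousLinearMap.lsmul ℝ ℝ) volume) x - c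
      = ∫ t, ρ.normed volume t * (u (x + p - t) - u (x - t) - c) := by
    have : (fun t => ρ.normed volume t * (u (x + p - t) - u (x - t) - c))
      = fun t => (ρ.normed volume t * u (x + p - t) - ρ.normed volume t * u (x - t))
          - ρ.normed volume t * c := by ext t; ring
    rw [this, integral_sub (by exact (hint _).sub (hint _)) (hρ.mul_const c),
      integral_sub (hint _) (hint _), integral_mul_const, h1, one_mul]
    rfl
  rw [e]
  have : ‖∫ t, ρ.normed volume t * (u (x + p - t) - u (x - t) - c)‖
      ≤ ∫ t, ρ.normed (volume : Measure (En n)) t * ε := by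
    apply norm_integral_le_of_norm_le (hρ.mul_const ε)
    refine Eventually.of_forall fun t => ?_
    rw [norm_mul, Real.norm_of_nonneg (ρ.nonneg_normed t)]
    by_cases ht : t ∈ Metric.ball (0 : En n) ρ.rOut
    · refine mul_le_mul_of_nonneg_left ?_ (ρ.nonneg_normed t)
      have := h (x - t) (by simpa [dist_eq_norm] using ht)
      rw [Real.norm_eq_abs]
      rwa [show x + p - t = x - t + p by abel]
    · rw [← ρ.support_normed_eq (μ := volume)] at ht
      simp [Function.notMem_support.1 ht]
  rwa [integral_mul_const, h1, one_mul] at this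

/-- bump of outer radius `2/(k+1)` -/
def bmp (n k : ℕ) : ContDiffBump (0 : En n) where
  rIn := 1 / ((k : ℝ) + 1)
  rOut := 2 / ((k : ℝ) + 1)
  rIn_pos := by positivity
  rIn_lt_rOut := by gcongr; norm_num

/-- mollification -/
def moll {n : ℕ} (u : En n → ℝ) (k : ℕ) : En n → ℝ :=
  convolution ((bmp n k).normed volume) u (ContinuousLinearMap.lsmul ℝ ℝ) volume

lemma moll_smooth {n : ℕ} (u : En n → ℝ) (hu : Continuous u) (k : ℕ) :
    ContDiff ℝ (⊤ : ℕ∞) (moll u k) :=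
  (bmp n k).hasCompactSupport_normed.contDiff_convolution_left _ (bmp n k).contDiff_normed
    hu.locallyIntegrable

lemma moll_fderiv_bound {n : ℕ} (u : En n → ℝ) (L : NNReal) (hu : LipschitzWith L u) (k : ℕ)
    (x v : En n) : |fderiv ℝ (moll u k) x v| ≤ L * ‖v‖ := by
  have hl : LipschitzWith L (moll u k) := by
    apply LipschitzWith.of_dist_le_mul
    intro a b
    have := smul_avg (bmp n k) u hu.continuous b (a - b) 0 (L * dist a b) (by
      intro z _
      have := hu.dist_le_mul (z + (a - b)) z
      rw [Real.dist_eq] at this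
      simpa [dist_eq_norm] using this)
    rw [Real.dist_eq]
    simpa [moll] using this
  have := norm_fderiv_le_of_lipschitz ℝ (x₀ := x) hl
  exact ((fderiv ℝ (moll u k) x).le_opNorm v).trans (by gcongr)

lemma moll_fderiv_tendsto {n : ℕ} (u : En n → ℝ) (hu : Continuous u)
    (x v : En n) (w : ℝ)
    (h : ∀ η > 0, ∃ δ > 0, ∀ z ∈ Metric.ball x δ, ∀ s ∈ Ioo (0 : ℝ) δ,
      |u (z + s • v) - u z - s * w| ≤ η * s) :
    Tendsto (fun k => fderiv ℝ (moll u k) x v) atTop (𝓝 w) := by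
  rw [Metric.tendsto_atTop]
  intro ε hε
  obtain ⟨δ, hδ, H⟩ := h (ε / 2) (by positivity)
  obtain ⟨N, hN⟩ := exists_nat_gt (2 / δ)
  refine ⟨N, fun k hk => ?_⟩
  have hr : (bmp n k).rOut ≤ δ := by
    change 2 / ((k : ℝ) + 1) ≤ δ
    rw [div_le_iff₀ (by positivity)]
    rw [div_lt_iff₀ hδ] at hN
    have : (N : ℝ) ≤ k := by exact_mod_cast hk
    nlinarith
  have hd : HasDerivAt (fun s : ℝ => moll u k (x + s • v)) (fderiv ℝ (moll u k) x v) 0 := by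
    have h1 : HasFDerivAt (moll u k) (fderiv ℝ (moll u k) x) (x + (0 : ℝ) • v) := by
      simpa using ((moll_smooth u hu k).differentiable (by simp) x).hasFDerivAt
    have h2 : HasDerivAt (fun s : ℝ => x + s • v) v 0 := by
      simpa using ((hasDerivAt_id (0 : ℝ)).smul_const v).const_add x
    exact h1.comp_hasDerivAt 0 h2
  have hs := hd.tendsto_slope_zero_right
  have : |fderiv ℝ (moll u k) x v - w| ≤ ε / 2 := by
    have ht := (hs.sub_const w).abs
    refine le_of_tendsto ht ?_
    filter_upwards [Ioo_mem_nhdsGT hδ] with s hs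
    have := smul_avg (bmp n k) u hu x (s • v) (s * w) (ε / 2 * s)
      (fun z hz => H z (Metric.ball_subset_ball hr hz) s hs)
    change |moll u k (x + s • v) - moll u k x - s * w| ≤ _ at this
    have e : s⁻¹ • (moll u k (x + (0 + s) • v) - moll u k (x + (0 : ℝ) • v)) - w
      = s⁻¹ * (moll u k (x + s • v) - moll u k x - s * w) := by
      have := hs.1.ne'
      simp only [zero_add, zero_smul, add_zero, smul_eq_mul]
      field_simp
    rw [e, abs_mul, abs_of_pos (inv_pos.2 hs.1), inv_mul_le_iff₀ hs.1]
    linarith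
  rw [Real.dist_eq]
  linarith

lemma limA {n : ℕ} (𝒰 Ω : Set (En n)) (V : En n → En n) (hV : ContinuousOn V 𝒰)
    (hΩopen : IsOpen Ω) (hΩ𝒰 : Ω ⊆ 𝒰)
    (A : ℕ → En n → Matrix (Fin n) (Fin n) ℝ) (hA : IsNullSeq 𝒰 A)
    (μs : ℕ → Measure (En n)) (hμs : ∀ k, IsStationaryMeasure (A k) V Ω (μs k))
    (μ : Measure (En n)) (hlim : WeakStarLimOn Ω μs μ)
    (f : En n → ℝ) (hf : ContDiff ℝ (⊤ : ℕ∞) f) (hfc : HasCompactSupport f)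
    (hfs : tsupport f ⊆ Ω) : ∫ x in Ω, fderiv ℝ f x (V x) ∂μ = 0 := by
  have hDc : ContinuousOn (fun x => fderiv ℝ f x (V x)) Ω :=
    ((hf.continuous_fderiv (by simp)).continuousOn).clm_apply (hV.mono hΩ𝒰)
  have hDb : ∃ C, ∀ x ∈ Ω, |fderiv ℝ f x (V x)| ≤ C := by
    obtain ⟨C, hC⟩ := hfc.isCompact.exists_bound_of_continuousOn (hDc.mono hfs)
    refine ⟨max C 0, fun x _ => ?_⟩
    by_cases hx : x ∈ tsupport f
    · exact (hC x hx).trans (le_max_left _ _)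
    · have : fderiv ℝ f x = 0 := by
        by_contra h
        exact hx (support_fderiv_subset ℝ h)
      simp [this]
  have ht := hlim _ hDc hDb
  refine tendsto_nhds_unique ht ?_
  have hle : ((2 : ℕ) : WithTop ℕ∞) ≤ ((⊤ : ℕ∞) : WithTop ℕ∞) := by
    exact WithTop.coe_le_coe.2 (le_top : ((2 : ℕ) : ℕ∞) ≤ ⊤)
  obtain ⟨M, hM⟩ : ∃ M, ∀ x, ‖iteratedFDeriv ℝ 2 f x‖ ≤ M :=
    (hfc.iteratedFDeriv 2).exists_bound_of_continuous (hf.continuous_iteratedFDeriv hle)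
  have hM0 : 0 ≤ M := (norm_nonneg _).trans (hM 0)
  let H : En n → Fin n → Fin n → ℝ := fun x i j =>
    iteratedFDeriv ℝ 2 f x ![EuclideanSpace.single i (1 : ℝ), EuclideanSpace.single j (1 : ℝ)]
  have hH : ∀ x i j, |H x i j| ≤ M := by
    intro x i j
    refine ((iteratedFDeriv ℝ 2 f x).le_opNorm _).trans ?_
    simpa [Fin.prod_univ_two] using hM x
  have hHc : ∀ i j, Continuous fun x => H x i j := by
    intro i j
    have : Continuous (iteratedFDeriv ℝ 2 f) := hf.continuous_iteratedFDeriv hle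
    exact (ContinuousMultilinearMap.apply ℝ (fun _ : Fin 2 => En n) ℝ
      ![EuclideanSpace.single i (1 : ℝ), EuclideanSpace.single j (1 : ℝ)]).continuous.comp this
  have hH0 : ∀ x, x ∉ tsupport f → ∀ i j, H x i j = 0 := by
    intro x hx i j
    have : iteratedFDeriv ℝ 2 f x = 0 := by
      by_contra h
      exact hx (support_iteratedFDeriv_subset 2 h)
    simp [H, this]
  rw [Metric.tendsto_atTop]
  intro ε hε
  obtain ⟨η, hη, hηε⟩ : ∃ η > 0, (n : ℝ) * (n * (η * M)) < ε := by
    refine ⟨ε / (n * n * M + 1), by positivity, ?_⟩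
    have : 0 ≤ (n : ℝ) * n * M := by positivity
    rw [show (n : ℝ) * (n * (ε / (n * n * M + 1) * M)) = ε * ((n * n * M) / (n * n * M + 1)) by
      ring]
    have : ((n : ℝ) * n * M) / (n * n * M + 1) < 1 := by
      rw [div_lt_one (by positivity)]; linarith
    nlinarith
  obtain ⟨N, hN⟩ := hA.2.2 (tsupport f) (hfs.trans hΩ𝒰) hfc.isCompact η hη
  refine ⟨N, fun k hk => ?_⟩
  obtain ⟨⟨hp, -⟩, hst⟩ := hμs k
  have hst := hst f hf hfc hfs
  let R : En n → ℝ := fun x => ∑ i, ∑ j, A k x i j * H x i j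
  have hRb : ∀ x, |R x| ≤ (n : ℝ) * (n * (η * M)) := by
    intro x
    refine (Finset.abs_sum_le_sum_abs _ _).trans ?_
    refine (Finset.sum_le_card_nsmul _ _ ((n * (η * M) : ℝ)) ?_).trans (by simp)
    intro i _
    refine (Finset.abs_sum_le_sum_abs _ _).trans ?_
    refine (Finset.sum_le_card_nsmul _ _ ((η * M : ℝ)) ?_).trans (by simp)
    intro j _
    by_cases hx : x ∈ tsupport f
    · rw [abs_mul]
      exact mul_le_mul (hN k hk x hx i j) (hH x i j) (abs_nonneg _) hη.le
    · rw [hH0 x hx]; simp; positivity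
  have hRc : ContinuousOn R Ω := by
    refine continuousOn_finsetSum _ fun i _ => continuousOn_finsetSum _ fun j _ => ?_
    refine ContinuousOn.mul ?_ (hHc i j).continuousOn
    have := (hA.1 k).mono hΩ𝒰
    exact (continuous_apply_apply i j).comp_continuousOn this
  have hRi : Integrable R ((μs k).restrict Ω) :=
    Integrable.of_bound (hRc.aestronglyMeasurable hΩopen.measurableSet) _
      (Eventually.of_forall hRb)
  have hDi : Integrable (fun x => fderiv ℝ f x (V x)) ((μs k).restrict Ω) := by
    obtain ⟨C, hC⟩ := hDb
    refine Integrable.of_bound (hDc.aestronglyMeasurable hΩopen.measurableSet) C ?_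
    exact (ae_restrict_mem hΩopen.measurableSet).mono hC
  have hsum : ∫ x in Ω, R x ∂μs k + ∫ x in Ω, fderiv ℝ f x (V x) ∂μs k = 0 := by
    rw [← integral_add hRi hDi]; exact hst
  have hb : ‖∫ x in Ω, R x ∂μs k‖ ≤ (n : ℝ) * (n * (η * M)) := by
    refine (norm_integral_le_of_norm_le_const (Eventually.of_forall hRb)).trans ?_
    have : ((μs k).restrict Ω).real univ ≤ 1 := by
      simp
    exact mul_le_of_le_one_right (by positivity) this
  rw [Real.dist_eq, sub_zero, eq_neg_of_add_eq_zero_right hsum, abs_neg]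
  exact hb.trans_lt hηε

lemma limA' {n : ℕ} (Ω : Set (En n)) (V : En n → En n)
    (hΩopen : IsOpen Ω) (μ : Measure (En n))
    (hA : ∀ f : En n → ℝ, ContDiff ℝ (⊤ : ℕ∞) f → HasCompactSupport f →
      tsupport f ⊆ Ω → ∫ x in Ω, fderiv ℝ f x (V x) ∂μ = 0)
    (hμ : μ Ωᶜ = 0)
    (K : Set (En n)) (hK : IsCompact K) (hKΩ : K ⊆ Ω) (hKμ : ∀ᵐ x ∂μ, x ∈ K)
    (f : En n → ℝ) (hf : ContDiff ℝ (⊤ : ℕ∞) f) :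
    ∫ x, fderiv ℝ f x (V x) ∂μ = 0 := by
  obtain ⟨T, hT, hKT, hTΩ⟩ := exists_compact_between hK hΩopen hKΩ
  obtain ⟨χ, h1, h0, -⟩ := exists_contMDiffMap_one_nhds_of_subset_interior
    (n := (⊤ : ℕ∞)) (modelWithCornersSelf ℝ (En n)) hK.isClosed hKT
  have hχ : ContDiff ℝ (⊤ : ℕ∞) (χ : En n → ℝ) := χ.contMDiff.contDiff
  have hts : tsupport (fun x => χ x * f x) ⊆ T := by
    refine closure_minimal (fun x hx => ?_) hT.isClosed
    by_contra h
    exact hx (by simp [h0 x h])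
  have := hA (fun x => χ x * f x) (hχ.mul hf) (hT.of_isClosed_subset (isClosed_tsupport _) hts)
    (hts.trans hTΩ)
  rw [Measure.restrict_eq_self_of_ae_mem (by rw [ae_iff]; exact hμ)] at this
  rw [← this]
  refine integral_congr_ae ?_
  filter_upwards [hKμ] with x hx
  have : (fun x => χ x * f x) =ᶠ[𝓝 x] f := by
    filter_upwards [h1.filter_mono (nhds_le_nhdsSet hx)] with y hy
    simp [hy]
  exact congrArg (fun T : En n →L[ℝ] ℝ => T (V x)) this.fderiv_eq.symm

lemma lip_of_compact {n : ℕ} {F : Type*} [NormedAddCommGroup F] [NormedSpace ℝ F]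
    (g : En n → F) (U S : Set (En n)) (hU : IsOpen U)
    (hg : ContDiffOn ℝ 1 g U) (hS : IsCompact S) (hSU : S ⊆ U) :
    ∃ K, LipschitzOnWith K g S := by
  apply LocallyLipschitzOn.exists_lipschitzOnWith_of_compact hS
  intro x hx
  obtain ⟨K, t, ht, h⟩ := (hg.contDiffAt (hU.mem_nhds (hSU hx))).exists_lipschitzOnWith
  exact ⟨K, t, mem_nhdsWithin_of_mem_nhds ht, h⟩

lemma flow_lip {n : ℕ} (V : En n → En n) (Ω' : Set (En n)) (φ : ℝ → En n → En n)
    (hφ : IsSemiflowOn V Ω' φ) (K : NNReal) (hK : LipschitzOnWith K V (closure Ω'))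
    (t : ℝ) (ht : 0 ≤ t) :
    LipschitzOnWith (Real.exp (K * t)).toNNReal (φ t) Ω' := by
  obtain ⟨hc, hin, h0, hadd, hd⟩ := hφ
  apply LipschitzOnWith.of_dist_le_mul
  intro x hx y hy
  have hcont : ∀ z ∈ Ω', ContinuousOn (fun τ => φ τ z) (Icc 0 t) := fun z hz τ hτ =>
    ((hd z hz τ hτ.1).continuousWithinAt).mono Icc_subset_Ici_self
  have hder : ∀ z ∈ Ω', ∀ τ ∈ Ico 0 t,
      HasDerivWithinAt (fun τ => φ τ z) (V (φ τ z)) (Ici τ) τ := fun z hz τ hτ =>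
    (hd z hz τ hτ.1).mono (Ici_subset_Ici.2 hτ.1)
  have := dist_le_of_trajectories_ODE_of_mem (v := fun _ => V) (s := fun _ => closure Ω')
    (K := K) (fun _ _ => hK) (hcont x hx) (hder x hx)
    (fun τ hτ => subset_closure (hin τ hτ.1 x hx)) (hcont y hy) (hder y hy)
    (fun τ hτ => subset_closure (hin τ hτ.1 y hy)) (δ := dist x y)
    (by rw [h0 x hx, h0 y hy]) t ⟨ht, le_rfl⟩
  rw [Real.coe_toNNReal _ (Real.exp_pos _).le, mul_comm]
  simpa using this

lemma strict_dir {n : ℕ} (V : En n → En n) (Ω' : Set (En n)) (hΩ' : IsOpen Ω')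
    (hV : ContinuousOn V Ω')
    (φ : ℝ → En n → En n) (hφ : IsSemiflowOn V Ω' φ) (f : En n → ℝ)
    (hf : ContDiff ℝ (⊤ : ℕ∞) f) (t : ℝ) (ht : 0 ≤ t)
    (u : En n → ℝ) (L : NNReal) (hu : LipschitzWith L u)
    (huf : EqOn (fun x => f (φ t x)) u Ω') (x : En n) (hx : x ∈ Ω') :
    ∀ η > 0, ∃ δ > 0, ∀ z ∈ Metric.ball x δ, ∀ s ∈ Ioo (0 : ℝ) δ,
      |u (z + s • V x) - u z - s * fderiv ℝ f (φ t x) (V (φ t x))| ≤ η * s := by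
  obtain ⟨hc, hin, h0, hadd, hd⟩ := hφ
  intro η hη
  set w := fderiv ℝ f (φ t x) (V (φ t x)) with hw
  have hWc : ContinuousOn (fun p => fderiv ℝ f p (V p)) Ω' :=
    ((hf.continuous_fderiv (by simp)).continuousOn).clm_apply hV
  have hct : ContinuousOn (φ t) Ω' :=
    hc.comp (f := fun z => (t, z)) (by fun_prop) (fun z hz => ⟨ht, hz⟩)
  have c1 : ContinuousOn (fun p : ℝ × En n => V (φ p.1 p.2)) (Ici (0 : ℝ) ×ˢ Ω') :=
    hV.comp hc (fun p hp => hin _ hp.1 _ hp.2)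
  have c2 : ContinuousOn (fun p : ℝ × En n => φ p.1 (φ t p.2)) (Ici (0 : ℝ) ×ˢ Ω') := by
    refine hc.comp (f := fun p : ℝ × En n => (p.1, φ t p.2)) ?_
      (fun p hp => ⟨hp.1, hin t ht _ hp.2⟩)
    exact continuousOn_fst.prodMk (hct.comp continuousOn_snd (fun p hp => hp.2))
  have c3 : ContinuousOn (fun p : ℝ × En n => fderiv ℝ f (φ p.1 (φ t p.2)) (V (φ p.1 (φ t p.2))))
      (Ici (0 : ℝ) ×ˢ Ω') :=
    hWc.comp c2 (fun p hp => hin _ hp.1 _ (hin t ht _ hp.2))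
  have hmem : ((0 : ℝ), x) ∈ Ici (0 : ℝ) ×ˢ Ω' := ⟨le_refl (0 : ℝ), hx⟩
  set η₁ := η / (2 * (L + 1)) with hη₁
  have hη₁p : 0 < η₁ := by positivity
  obtain ⟨δ₁, hδ₁, H₁⟩ := Metric.continuousWithinAt_iff.1 (c1 _ hmem) η₁ hη₁p
  obtain ⟨δ₂, hδ₂, H₂⟩ := Metric.continuousWithinAt_iff.1 (c3 _ hmem) (η / 2) (by positivity)
  obtain ⟨δ₃, hδ₃, H₃⟩ := Metric.isOpen_iff.1 hΩ' x hx
  refine ⟨min (min δ₁ δ₂) δ₃, by positivity, fun z hz s hs => ?_⟩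
  rw [Metric.mem_ball, lt_min_iff, lt_min_iff] at hz
  have hzΩ : z ∈ Ω' := H₃ hz.2
  have hs2 := hs.2
  rw [lt_min_iff, lt_min_iff] at hs2
  have hyΩ := hin t ht z hzΩ
  -- distance of the pair
  have hpair : ∀ δ, dist z x < δ → s < δ → ∀ r ∈ Icc 0 s, dist ((r : ℝ), z) ((0 : ℝ), x) < δ := by
    intro δ h1 h2 r hr
    rw [Prod.dist_eq, max_lt_iff]
    refine ⟨?_, h1⟩
    rw [Real.dist_eq, sub_zero, abs_of_nonneg hr.1]
    exact hr.2.trans_lt h2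
  have hs0 : (0 : ℝ) ≤ s := hs.1.le
  -- first estimate
  have e1 : ‖(z + s • V x - φ s z)‖ ≤ η₁ * s := by
    have := norm_image_sub_le_of_norm_deriv_le_segment' (a := 0) (b := s) (C := η₁)
      (f := fun r => z + r • V x - φ r z) (f' := fun r => V x - V (φ r z)) (by
        intro r hr
        have h1 : HasDerivAt (fun r : ℝ => z + r • V x) (V x) r := by
          simpa using ((hasDerivAt_id r).smul_const (V x)).const_add z
        exact h1.hasDerivWithinAt.sub ((hd z hzΩ r hr.1).mono Icc_subset_Ici_self)) (by
        intro r hr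
        have := H₁ (x := (r, z)) ⟨hr.1, hzΩ⟩ (hpair δ₁ hz.1.1 hs2.1.1 r ⟨hr.1, hr.2.le⟩)
        simp only [h0 x hx] at this
        rw [dist_comm, dist_eq_norm] at this
        exact this.le) s ⟨hs0, le_rfl⟩
    simpa [h0 z hzΩ] using this
  have e2 : |u (z + s • V x) - u (φ s z)| ≤ η / 2 * s := by
    have := hu.dist_le_mul (z + s • V x) (φ s z)
    rw [Real.dist_eq, dist_eq_norm] at this
    refine this.trans ((mul_le_mul_of_nonneg_left e1 L.coe_nonneg).trans ?_)
    rw [← mul_assoc]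
    refine mul_le_mul_of_nonneg_right ?_ hs0
    rw [hη₁, mul_div_assoc', div_le_div_iff₀ (by positivity) (by positivity)]
    nlinarith [L.coe_nonneg]
  have e3 : |u (φ s z) - u z - s * w| ≤ η / 2 * s := by
    have h1 : u (φ s z) = f (φ s (φ t z)) := by
      rw [← huf (hin s hs0 z hzΩ)]
      simp only
      rw [← hadd t s ht hs0 z hzΩ, ← hadd s t hs0 ht z hzΩ, add_comm]
    have h2 : u z = f (φ 0 (φ t z)) := by rw [← huf hzΩ, h0 _ hyΩ]
    have := norm_image_sub_le_of_norm_deriv_le_segment' (a := 0) (b := s) (C := η / 2)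
      (f := fun r => f (φ r (φ t z)) - r * w)
      (f' := fun r => fderiv ℝ f (φ r (φ t z)) (V (φ r (φ t z))) - w) (by
        intro r hr
        have h1 : HasDerivAt (fun r : ℝ => r * w) w r := by
          simpa using (hasDerivAt_id r).mul_const w
        have h2 : HasFDerivAt f (fderiv ℝ f (φ r (φ t z))) (φ r (φ t z)) :=
          (hf.differentiable (by simp) _).hasFDerivAt
        exact (h2.comp_hasDerivWithinAt r ((hd _ hyΩ r hr.1).mono Icc_subset_Ici_self)).sub
          h1.hasDerivWithinAt) (by
        intro r hr
        have := H₂ (x := (r, z)) ⟨hr.1, hzΩ⟩ (hpair δ₂ hz.1.2 hs2.1.2 r ⟨hr.1, hr.2.le⟩)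
        simp only [h0 _ (hin t ht x hx)] at this
        rw [dist_eq_norm] at this
        exact this.le) s ⟨hs0, le_rfl⟩
    rw [h1, h2]
    rw [Real.norm_eq_abs] at this
    convert this using 2 <;> ring
  calc _ = |(u (z + s • V x) - u (φ s z)) + (u (φ s z) - u z - s * w)| := by congr 1; ring
    _ ≤ _ := (abs_add_le _ _).trans (by linarith)

lemma key_zero {n : ℕ} (V : En n → En n) (Ω' : Set (En n)) (hΩ' : IsOpen Ω')
    (hΩ'c : IsCompact (closure Ω')) (K : NNReal) (hK : LipschitzOnWith K V (closure Ω'))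
    (φ : ℝ → En n → En n) (hφ : IsSemiflowOn V Ω' φ)
    (μ : Measure (En n)) [IsProbabilityMeasure μ] (hμ : ∀ᵐ x ∂μ, x ∈ Ω')
    (hA : ∀ f : En n → ℝ, ContDiff ℝ (⊤ : ℕ∞) f → ∫ x, fderiv ℝ f x (V x) ∂μ = 0)
    (f : En n → ℝ) (hf : ContDiff ℝ (⊤ : ℕ∞) f) (t : ℝ) (ht : 0 ≤ t) :
    ∫ x, fderiv ℝ f (φ t x) (V (φ t x)) ∂μ = 0 := by
  have hV : ContinuousOn V Ω' := hK.continuousOn.mono subset_closure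
  have hin := hφ.2.1
  obtain ⟨Kf, hKf⟩ := lip_of_compact f univ (closure Ω') isOpen_univ
    (hf.of_le (by exact_mod_cast le_top)).contDiffOn hΩ'c (subset_univ _)
  have hl := (hKf.mono subset_closure).comp (flow_lip V Ω' φ hφ K hK t ht) (hin t ht)
  obtain ⟨u, hu, huf⟩ := hl.extend_real
  obtain ⟨C, hC⟩ := hΩ'c.exists_bound_of_continuousOn hK.continuousOn
  have hr : μ.restrict Ω' = μ := Measure.restrict_eq_self_of_ae_mem hμ
  generalize Kf * (Real.exp (K * t)).toNNReal = L at hu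
  have hT := tendsto_integral_of_dominated_convergence (μ := μ)
    (F := fun k x => fderiv ℝ (moll u k) x (V x))
    (f := fun x => fderiv ℝ f (φ t x) (V (φ t x))) (fun _ => L * C) (by
      intro k
      have : ContinuousOn (fun x => fderiv ℝ (moll u k) x (V x)) Ω' :=
        (((moll_smooth u hu.continuous k).continuous_fderiv (by simp)).continuousOn).clm_apply hV
      rw [← hr]
      exact this.aestronglyMeasurable hΩ'.measurableSet) (integrable_const _) (by
      intro k
      filter_upwards [hμ] with x hx
      refine (moll_fderiv_bound u L hu k x (V x)).trans ?_
      exact mul_le_mul_of_nonneg_left (hC x (subset_closure hx)) L.coe_nonneg) (by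
      filter_upwards [hμ] with x hx
      exact moll_fderiv_tendsto u hu.continuous x (V x) _
        (strict_dir V Ω' hΩ' hV φ hφ f hf t ht u L hu huf x hx))
  refine tendsto_nhds_unique hT ?_
  simp only [hA _ (moll_smooth u hu.continuous _)]
  exact tendsto_const_nhds

lemma key_inv {n : ℕ} (V : En n → En n) (Ω' : Set (En n)) (hΩ' : IsOpen Ω')
    (hΩ'c : IsCompact (closure Ω')) (K : NNReal) (hK : LipschitzOnWith K V (closure Ω'))
    (φ : ℝ → En n → En n) (hφ : IsSemiflowOn V Ω' φ)
    (μ : Measure (En n)) [IsProbabilityMeasure μ] (hμ : ∀ᵐ x ∂μ, x ∈ Ω')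
    (hA : ∀ f : En n → ℝ, ContDiff ℝ (⊤ : ℕ∞) f → ∫ x, fderiv ℝ f x (V x) ∂μ = 0)
    (f : En n → ℝ) (hf : ContDiff ℝ (⊤ : ℕ∞) f) (t : ℝ) (ht : 0 ≤ t) :
    ∫ x, f (φ t x) ∂μ = ∫ x, f x ∂μ := by
  have hz := key_zero V Ω' hΩ' hΩ'c K hK φ hφ μ hμ hA f hf
  obtain ⟨hc, hin, h0, hadd, hd⟩ := hφ
  have hr : μ.restrict Ω' = μ := Measure.restrict_eq_self_of_ae_mem hμ
  have hWc : ContinuousOn (fun p => fderiv ℝ f p (V p)) (closure Ω') :=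
    ((hf.continuous_fderiv (by simp)).continuousOn).clm_apply hK.continuousOn
  obtain ⟨C, hC⟩ := hΩ'c.exists_bound_of_continuousOn hWc
  obtain ⟨M, hM⟩ := hΩ'c.exists_bound_of_continuousOn hf.continuous.continuousOn
  have hct : ∀ s, 0 ≤ s → ContinuousOn (φ s) Ω' := fun s hs =>
    hc.comp (f := fun z => (s, z)) (by fun_prop) (fun z hz => ⟨hs, hz⟩)
  have hmeas : ∀ s, 0 ≤ s → AEStronglyMeasurable (fun x => f (φ s x)) μ := by
    intro s hs
    rw [← hr]
    exact (hf.continuous.comp_continuousOn (hct s hs)).aestronglyMeasurable hΩ'.measurableSet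
  have hmeas' : ∀ s, 0 ≤ s →
      AEStronglyMeasurable (fun x => fderiv ℝ f (φ s x) (V (φ s x))) μ := by
    intro s hs
    rw [← hr]
    exact ((hWc.mono subset_closure).comp (hct s hs) (hin s hs)).aestronglyMeasurable
      hΩ'.measurableSet
  have h00 : ∫ x, f (φ 0 x) ∂μ = ∫ x, f x ∂μ := by
    refine integral_congr_ae ?_
    filter_upwards [hμ] with x hx
    rw [h0 x hx]
  rcases ht.eq_or_lt with rfl | htp
  · exact h00
  have hcont : ContinuousOn (fun s => ∫ x, f (φ s x) ∂μ) (Icc 0 t) := by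
    refine continuousOn_of_dominated (bound := fun _ => M) (fun s hs => hmeas s hs.1) ?_
      (integrable_const _) ?_
    · intro s hs
      filter_upwards [hμ] with x hx
      exact hM _ (subset_closure (hin s hs.1 x hx))
    · filter_upwards [hμ] with x hx s hs
      exact hf.continuous.continuousAt.comp_continuousWithinAt
        ((hd x hx s hs.1).continuousWithinAt.mono Icc_subset_Ici_self)
  have hder : ∀ s ∈ Ioo 0 t, HasDerivAt (fun s => ∫ x, f (φ s x) ∂μ) 0 s := by
    intro s hs
    have := (hasDerivAt_integral_of_dominated_loc_of_deriv_le (μ := μ) (x₀ := s) (s := Ioi 0)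
      (F := fun s x => f (φ s x)) (F' := fun s x => fderiv ℝ f (φ s x) (V (φ s x)))
      (bound := fun _ => C) (Ioi_mem_nhds hs.1) ?_ ?_ (hmeas' s hs.1.le) ?_
      (integrable_const _) ?_).2
    · rwa [hz s hs.1.le] at this
    · filter_upwards [Ioi_mem_nhds hs.1] with r hr
      exact hmeas r (le_of_lt hr)
    · refine Integrable.of_bound (hmeas s hs.1.le) M ?_
      filter_upwards [hμ] with x hx
      exact hM _ (subset_closure (hin s hs.1.le x hx))
    · filter_upwards [hμ] with x hx r hr
      exact hC _ (subset_closure (hin r (le_of_lt hr) x hx))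
    · filter_upwards [hμ] with x hx r hr
      have h1 := (hd x hx r (le_of_lt hr)).hasDerivAt (Ici_mem_nhds hr)
      have h2 : HasFDerivAt f (fderiv ℝ f (φ r x)) (φ r x) :=
        (hf.differentiable (by simp) _).hasFDerivAt
      exact h2.comp_hasDerivAt r h1
  obtain ⟨c, -, hcc⟩ := exists_hasDerivAt_eq_slope (fun s => ∫ x, f (φ s x) ∂μ) (fun _ => 0)
    htp hcont hder
  rw [eq_comm, div_eq_zero_iff] at hcc
  rcases hcc with h | h
  · rw [← h00]; linarith
  · linarith

lemma charFun_split {n : ℕ} (m : Measure (En n)) [IsFiniteMeasure m] (ξ : En n) :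
    charFun m ξ = ((∫ x, Real.cos (inner ℝ x ξ) ∂m : ℝ) : ℂ)
      + ((∫ x, Real.sin (inner ℝ x ξ) ∂m : ℝ) : ℂ) * Complex.I := by
  have hc : Integrable (fun x : En n => Real.cos (inner ℝ x ξ)) m :=
    Integrable.of_bound (by fun_prop) 1 (Eventually.of_forall fun x => Real.abs_cos_le_one _)
  have hs : Integrable (fun x : En n => Real.sin (inner ℝ x ξ)) m :=
    Integrable.of_bound (by fun_prop) 1 (Eventually.of_forall fun x => Real.abs_sin_le_one _)
  rw [charFun_apply, ← integral_complex_ofReal, ← integral_complex_ofReal, ← integral_mul_const,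
    ← integral_add hc.ofReal (hs.ofReal.mul_const _)]
  refine integral_congr_ae (Eventually.of_forall fun x => ?_)
  simp only
  rw [Complex.exp_mul_I]
  simp

lemma measSupp_eq {n : ℕ} (μ : Measure (En n)) : measSupp μ = μ.support := by
  ext x
  rw [(nhds_basis_opens x).mem_measureSupport]
  exact ⟨fun h s hs => h s hs.2 hs.1, fun h s h1 h2 => h s ⟨h2, h1⟩⟩

/-- Let `V` be a `C¹` vector field on a connected open set `𝒰 ⊆ ℝⁿ`, `Ω ⊆ 𝒰`
a connected open set, `(A_k)` a null sequence of diffusion matrices on `𝒰`, `μ_k` stationary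
measures for `ℒ_{A_k}` on `Ω` with `μ_k → μ` weak*. Suppose there is an open set `Ω̃` with
compact closure contained in `Ω`, positively invariant under `V` with positive semiflow `φ`,
containing the support of `μ`. Then `μ` is an invariant measure of `φ` and its support is
contained in the ω-limit set `ω(Ω̃) = ∩_{τ≥0} closure(∪_{t≥τ} φ(t,Ω̃))`. -/
theorem stmt4 {n : ℕ} (hn : 1 ≤ n) (𝒰 Ω : Set (En n))
    (h𝒰open : IsOpen 𝒰) (h𝒰conn : IsConnected 𝒰)
    (V : En n → En n) (hV : ContDiffOn ℝ 1 V 𝒰)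
    (hΩopen : IsOpen Ω) (hΩconn : IsConnected Ω) (hΩ𝒰 : Ω ⊆ 𝒰)
    (A : ℕ → En n → Matrix (Fin n) (Fin n) ℝ) (hA : IsNullSeq 𝒰 A)
    (μs : ℕ → Measure (En n)) (hμs : ∀ k, IsStationaryMeasure (A k) V Ω (μs k))
    (μ : Measure (En n)) (hμ : IsProbOn Ω μ) (hlim : WeakStarLimOn Ω μs μ)
    (Ω' : Set (En n)) (hΩ'open : IsOpen Ω') (hΩ'cpt : IsCompact (closure Ω'))
    (hΩ'sub : closure Ω' ⊆ Ω)
    (φ : ℝ → En n → En n) (hφ : IsSemiflowOn V Ω' φ)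
    (hsupp : measSupp μ ⊆ Ω') :
    IsPosInvariantUnder Ω' φ μ ∧
      measSupp μ ⊆ ⋂ (τ : ℝ) (_ : 0 ≤ τ), closure (⋃ (t : ℝ) (_ : τ ≤ t), φ t '' Ω') := by
  obtain ⟨hprob, hμΩ⟩ := hμ
  have hKclosed : IsClosed (measSupp μ) := by
    rw [measSupp_eq]; exact Measure.isClosed_support
  have hKae : ∀ᵐ x ∂μ, x ∈ measSupp μ := by
    rw [measSupp_eq]; exact Measure.support_mem_ae
  have hae : ∀ᵐ x ∂μ, x ∈ Ω' := hKae.mono fun x hx => hsupp hx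
  have hr : μ.restrict Ω' = μ := Measure.restrict_eq_self_of_ae_mem hae
  have hKc : IsCompact (measSupp μ) :=
    hΩ'cpt.of_isClosed_subset hKclosed (hsupp.trans subset_closure)
  have hall : ∀ f : En n → ℝ, ContDiff ℝ (⊤ : ℕ∞) f → ∫ x, fderiv ℝ f x (V x) ∂μ = 0 :=
    fun f hf => limA' Ω V hΩopen μ
      (limA 𝒰 Ω V hV.continuousOn hΩopen hΩ𝒰 A hA μs hμs μ hlim) hμΩ (measSupp μ) hKc
      (hsupp.trans (subset_closure.trans hΩ'sub)) hKae f hf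
  obtain ⟨K, hK⟩ := lip_of_compact V 𝒰 (closure Ω') h𝒰open hV hΩ'cpt (hΩ'sub.trans hΩ𝒰)
  have hinv := key_inv V Ω' hΩ'open hΩ'cpt K hK φ hφ μ hae hall
  have hmain : IsPosInvariantUnder Ω' φ μ := by
    intro t ht B hB hBm
    have hct : ContinuousOn (φ t) Ω' :=
      hφ.1.comp (f := fun z => (t, z)) (by fun_prop) (fun z hz => ⟨ht, hz⟩)
    have hm : AEMeasurable (φ t) μ := by
      rw [← hr]; exact hct.aemeasurable hΩ'open.measurableSet
    have heq : μ.map (φ t) = μ := by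
      refine Measure.ext_of_charFun ?_
      ext ξ
      rw [charFun_split, charFun_split, integral_map hm (by fun_prop),
        integral_map hm (by fun_prop)]
      have h1 := hinv (fun x => Real.cos (inner ℝ x ξ)) (Real.contDiff_cos.comp (contDiff_id.inner ℝ contDiff_const)) t ht
      have h2 := hinv (fun x => Real.sin (inner ℝ x ξ)) (Real.contDiff_sin.comp (contDiff_id.inner ℝ contDiff_const)) t ht
      rw [h1, h2]
    rw [inter_comm, ← Measure.restrict_apply' hΩ'open.measurableSet, hr,
      ← Measure.map_apply_of_aemeasurable hm hBm, heq]
  refine ⟨hmain, ?_⟩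
  refine subset_iInter fun τ => subset_iInter fun hτ => ?_
  rw [measSupp_eq]
  refine Measure.support_subset_of_isClosed isClosed_closure ?_
  set C := closure (⋃ (t : ℝ) (_ : τ ≤ t), φ t '' Ω') with hC
  have h1 := hmain τ hτ (Ω' ∩ C) inter_subset_left
    (hΩ'open.measurableSet.inter isClosed_closure.measurableSet)
  have h2 : Ω' ∩ φ τ ⁻¹' (Ω' ∩ C) = Ω' := by
    refine inter_eq_left.2 fun x hx => ⟨hφ.2.1 τ hτ x hx, subset_closure ?_⟩
    exact mem_iUnion₂.2 ⟨τ, le_rfl, mem_image_of_mem _ hx⟩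
  have h3 : μ Ω' = 1 := (prob_compl_eq_zero_iff hΩ'open.measurableSet).1 hae
  rw [h2, h3] at h1
  have h4 : μ C = 1 := le_antisymm prob_le_one (h1.le.trans (measure_mono inter_subset_right))
  exact (prob_compl_eq_zero_iff isClosed_closure.measurableSet).2 h4

end
end

section
/- Let Ω ⊆ 𝒰 be a connected open set and suppose U is a C¹ compact function on Ω such that V(x)·∇U(x) ≤ 0 for all x ∈ Ω (an entire weak Lyapunov function), or V(x)·∇U(x) ≥ 0 for all x ∈ Ω (an entire weak anti-Lyapunov function). Let (A_k) be a null sequence of diffusion matrices on 𝒰, for each k let μ_k be a Borel probability measure on Ω that is a stationary measure for ℒ_{A_k} on Ω, and suppose μ_k → μ weak* where μ has compact support contained in Ω. Then the support of μ is contained in the set S = {x ∈ Ω : V(x)·∇U(x) = 0}. -/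
open MeasureTheory Set Filter Topology

noncomputable section

/-- A compact function on `Ω`: a continuous nonnegative function `U` with
`U x < ρ_M := sup_Ω U` everywhere and compact sublevel sets `{x ∈ Ω | U x ≤ ρ}`
for every `ρ < ρ_M` (the supremum is taken in `EReal`, allowing `ρ_M = ∞`). -/
def IsCompactFunctionOn {n : ℕ} (U : En n → ℝ) (Ω : Set (En n)) : Prop :=
  ContinuousOn U Ω ∧ (∀ x ∈ Ω, 0 ≤ U x) ∧
  (∀ x ∈ Ω, (U x : EReal) < ⨆ y ∈ Ω, (U y : EReal)) ∧
  (∀ ρ : ℝ, (ρ : EReal) < ⨆ y ∈ Ω, (U y : EReal) → IsCompact {x ∈ Ω | U x ≤ ρ})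

theorem aux_bdd {n : ℕ} {Ω K : Set (En n)} (hK : IsCompact K) (hKΩ : K ⊆ Ω)
    {h : En n → ℝ} (hc : ContinuousOn h Ω) (h0 : ∀ x, x ∉ K → h x = 0) :
    ∃ C, 0 ≤ C ∧ ∀ x, |h x| ≤ C := by
  obtain ⟨C, hC⟩ := hK.exists_bound_of_continuousOn (hc.mono hKΩ)
  refine ⟨max C 0, le_max_right _ _, fun x => ?_⟩
  by_cases hx : x ∈ K
  · exact (hC x hx).trans (le_max_left _ _)
  · rw [h0 x hx]; simp

theorem aux_int {n : ℕ} {Ω K : Set (En n)} (hΩ : IsOpen Ω) (hK : IsCompact K) (hKΩ : K ⊆ Ω)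
    {h : En n → ℝ} (hc : ContinuousOn h Ω) (h0 : ∀ x, x ∉ K → h x = 0)
    (ν : Measure (En n)) [IsProbabilityMeasure ν] : Integrable h (ν.restrict Ω) := by
  obtain ⟨C, -, hC⟩ := aux_bdd hK hKΩ hc h0
  exact Integrable.of_bound (hc.aestronglyMeasurable hΩ.measurableSet) C
    (Eventually.of_forall hC)

theorem aux_abs {n : ℕ} {Ω : Set (En n)} {h : En n → ℝ} {C : ℝ} (hC0 : 0 ≤ C)
    (hC : ∀ x, |h x| ≤ C)
    (ν : Measure (En n)) [IsProbabilityMeasure ν] : |∫ x in Ω, h x ∂ν| ≤ C := by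
  have h1 := norm_integral_le_of_norm_le_const (μ := ν.restrict Ω) (f := h) (C := C)
    (Eventually.of_forall hC)
  refine h1.trans ?_
  have h2 : (ν.restrict Ω).real univ ≤ 1 := by
    rw [measureReal_restrict_apply_univ]; exact measureReal_le_one
  calc C * _ ≤ C * 1 := mul_le_mul_of_nonneg_left h2 hC0
    _ = C := mul_one C

theorem aux_smooth {n : ℕ} (𝒰 Ω : Set (En n))
    (V : En n → En n) (hV : ContinuousOn V 𝒰)
    (hΩopen : IsOpen Ω) (hΩ𝒰 : Ω ⊆ 𝒰)
    (A : ℕ → En n → Matrix (Fin n) (Fin n) ℝ) (hA : IsNullSeq 𝒰 A)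
    (μs : ℕ → Measure (En n)) (hμs : ∀ k, IsStationaryMeasure (A k) V Ω (μs k))
    (μ : Measure (En n)) (hlim : WeakStarLimOn Ω μs μ)
    (f : En n → ℝ) (hf : ContDiff ℝ (⊤ : ℕ∞) f) (hfc : HasCompactSupport f)
    (hfΩ : tsupport f ⊆ Ω) :
    ∫ x in Ω, fderiv ℝ f x (V x) ∂μ = 0 := by
  have hK : IsCompact (tsupport f) := hfc
  have hgc : ContinuousOn (fun x => fderiv ℝ f x (V x)) Ω :=
    (hf.continuous_fderiv (by simp)).continuousOn.clm_apply (hV.mono hΩ𝒰)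
  have hg0 : ∀ x, x ∉ tsupport f → fderiv ℝ f x (V x) = 0 := by
    intro x hx
    rw [fderiv_of_notMem_tsupport ℝ hx]; simp
  obtain ⟨C, hC0, hC⟩ := aux_bdd hK hfΩ hgc hg0
  have ht := hlim _ hgc ⟨C, fun x _ => hC x⟩
  refine tendsto_nhds_unique ht ?_
  let D : Fin n → Fin n → En n → ℝ := fun i j x =>
    iteratedFDeriv ℝ 2 f x ![EuclideanSpace.single i (1 : ℝ), EuclideanSpace.single j (1 : ℝ)]
  have hDc : ∀ i j, Continuous (D i j) := by
    intro i j
    have h2 : Continuous (iteratedFDeriv ℝ 2 f) :=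
      hf.continuous_iteratedFDeriv (m := 2) (WithTop.coe_le_coe.2 (le_top : (2 : ℕ∞) ≤ ⊤))
    exact (ContinuousMultilinearMap.apply ℝ (fun _ : Fin 2 => En n) ℝ
      ![EuclideanSpace.single i (1 : ℝ), EuclideanSpace.single j (1 : ℝ)]).continuous.comp h2
  have hD0 : ∀ i j x, x ∉ tsupport f → D i j x = 0 := by
    intro i j x hx
    have : iteratedFDeriv ℝ 2 f x = 0 := by
      by_contra hne
      exact hx (support_iteratedFDeriv_subset (𝕜 := ℝ) 2 hne)
    simp [D, this]
  have hDb : ∀ i j, ∃ B, 0 ≤ B ∧ ∀ x, |D i j x| ≤ B := fun i j =>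
    aux_bdd hK hfΩ (hDc i j).continuousOn (hD0 i j)
  choose B hB0 hB using hDb
  let T := ∑ i, ∑ j, B i j
  have hT0 : 0 ≤ T := Finset.sum_nonneg fun i _ => Finset.sum_nonneg fun j _ => hB0 i j
  obtain ⟨hA1, -, hA3⟩ := hA
  rw [Metric.tendsto_atTop]
  intro ε hε
  obtain ⟨N, hN⟩ := hA3 (tsupport f) (hfΩ.trans hΩ𝒰) hK (ε / (2 * (T + 1))) (by positivity)
  refine ⟨N, fun k hk => ?_⟩
  have := (hμs k).1.1
  let S : En n → ℝ := fun x => ∑ i, ∑ j, A k x i j * D i j x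
  have hSc : ContinuousOn S Ω := by
    refine continuousOn_finsetSum _ fun i _ => continuousOn_finsetSum _ fun j _ => ?_
    refine ContinuousOn.mul ?_ (hDc i j).continuousOn
    exact ((continuous_apply j).comp (continuous_apply i)).comp_continuousOn
      ((hA1 k).mono hΩ𝒰)
  have hS0 : ∀ x, x ∉ tsupport f → S x = 0 := by
    intro x hx
    simp [S, hD0 _ _ x hx]
  have hSb : ∀ x, |S x| ≤ ε / (2 * (T + 1)) * T := by
    intro x
    by_cases hx : x ∈ tsupport f
    · simp only [S, T, Finset.mul_sum]
      refine (Finset.abs_sum_le_sum_abs _ _).trans (Finset.sum_le_sum fun i _ => ?_)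
      refine (Finset.abs_sum_le_sum_abs _ _).trans (Finset.sum_le_sum fun j _ => ?_)
      rw [abs_mul]
      exact mul_le_mul (hN k hk x hx i j) (hB i j x) (abs_nonneg _) (by positivity)
    · rw [hS0 x hx, abs_zero]; positivity
  have hst := (hμs k).2 f hf hfc hfΩ
  have hadd : ∫ x in Ω, adjFP (A k) V f x ∂μs k
      = ∫ x in Ω, S x ∂μs k + ∫ x in Ω, fderiv ℝ f x (V x) ∂μs k :=
    integral_add (aux_int hΩopen hK hfΩ hSc hS0 (μs k)) (aux_int hΩopen hK hfΩ hgc hg0 (μs k))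
  have hab := aux_abs (Ω := Ω) (by positivity) hSb (μs k)
  have hlt : ε / (2 * (T + 1)) * T < ε := by
    rw [div_mul_eq_mul_div, div_lt_iff₀ (by positivity)]
    nlinarith
  rw [Real.dist_eq, sub_zero]
  have : ∫ x in Ω, fderiv ℝ f x (V x) ∂μs k = - ∫ x in Ω, S x ∂μs k := by linarith
  rw [this, abs_neg]
  exact hab.trans_lt hlt

open scoped Convolution in
theorem aux_moll {n : ℕ} (g : En n → ℝ) (hg : ContDiff ℝ 1 g) (hgc : HasCompactSupport g)
    (δ : ℝ) (hδ : 0 < δ) (ε : ℝ) (hε : 0 < ε) :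
    ∃ f : En n → ℝ, ContDiff ℝ (⊤ : ℕ∞) f ∧ tsupport f ⊆ Metric.cthickening δ (tsupport g) ∧
      ∀ x, ‖fderiv ℝ f x - fderiv ℝ g x‖ ≤ ε := by
  have hdc : Continuous (fderiv ℝ g) := hg.continuous_fderiv (by simp)
  have huc : UniformContinuous (fderiv ℝ g) :=
    hdc.uniformContinuous_of_tendsto_cocompact (hgc.fderiv ℝ).is_zero_at_infty
  obtain ⟨η, hη, hη'⟩ := Metric.uniformContinuous_iff.1 huc ε hε
  let r := min η δ
  have hr : 0 < r := lt_min hη hδ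
  let φ : ContDiffBump (0 : En n) := ⟨r / 2, r, by positivity, by linarith⟩
  have hgl : LocallyIntegrable g (volume : Measure (En n)) :=
    hg.continuous.locallyIntegrable
  have hφl : LocallyIntegrable (φ.normed volume) (volume : Measure (En n)) :=
    φ.continuous_normed.locallyIntegrable
  refine ⟨φ.normed volume ⋆[ContinuousLinearMap.lsmul ℝ ℝ, volume] g, ?_, ?_, ?_⟩
  · exact φ.hasCompactSupport_normed.contDiff_convolution_left _ φ.contDiff_normed hgl
  · refine closure_minimal ?_ Metric.isClosed_cthickening
    intro x hx
    by_contra hxK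
    have hz : ∀ y ∈ Metric.ball x r, g y = 0 := by
      intro y hy
      by_contra hne
      apply hxK
      refine Metric.mem_cthickening_of_dist_le x y δ _ (subset_tsupport g hne) ?_
      rw [dist_comm]
      exact (Metric.mem_ball.1 hy).le.trans (min_le_right _ _)
    apply hx
    rw [φ.normed_convolution_eq_right]
    · exact hz x (Metric.mem_ball_self hr)
    · intro y hy
      rw [hz y hy, hz x (Metric.mem_ball_self hr)]
  · intro x
    have h1 := hgc.hasFDerivAt_convolution_right (ContinuousLinearMap.lsmul ℝ ℝ) hφl hg x
    rw [h1.fderiv]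
    have h2 : (φ.normed volume ⋆[(ContinuousLinearMap.lsmul ℝ ℝ).precompR (En n), volume]
        fderiv ℝ g) x = (φ.normed volume ⋆[ContinuousLinearMap.lsmul ℝ ℝ, volume]
        fderiv ℝ g) x := by
      rfl
    rw [h2, ← dist_eq_norm]
    refine φ.dist_normed_convolution_le hdc.aestronglyMeasurable ?_
    intro y hy
    exact (hη' ((Metric.mem_ball.1 hy).trans_le (min_le_left _ _))).le

theorem aux_C1 {n : ℕ} (𝒰 Ω : Set (En n))
    (V : En n → En n) (hV : ContinuousOn V 𝒰)
    (hΩopen : IsOpen Ω) (hΩ𝒰 : Ω ⊆ 𝒰)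
    (μ : Measure (En n)) [IsProbabilityMeasure μ]
    (hsm : ∀ f : En n → ℝ, ContDiff ℝ (⊤ : ℕ∞) f → HasCompactSupport f → tsupport f ⊆ Ω →
      ∫ x in Ω, fderiv ℝ f x (V x) ∂μ = 0)
    (g : En n → ℝ) (hg : ContDiff ℝ 1 g) (hgc : HasCompactSupport g)
    (hgΩ : tsupport g ⊆ Ω) :
    ∫ x in Ω, fderiv ℝ g x (V x) ∂μ = 0 := by
  have hK : IsCompact (tsupport g) := hgc
  obtain ⟨δ, hδ, hδΩ⟩ := hK.exists_cthickening_subset_open hΩopen hgΩ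
  have hK' : IsCompact (Metric.cthickening δ (tsupport g)) := hK.cthickening
  obtain ⟨M, hM⟩ := hK'.exists_bound_of_continuousOn (hV.mono (hδΩ.trans hΩ𝒰))
  have hcont : ∀ f : En n → ℝ, ContDiff ℝ 1 f →
      ContinuousOn (fun x => fderiv ℝ f x (V x)) Ω := fun f hf =>
    (hf.continuous_fderiv (by simp)).continuousOn.clm_apply (hV.mono hΩ𝒰)
  have hzero : ∀ f : En n → ℝ, tsupport f ⊆ Metric.cthickening δ (tsupport g) →
      ∀ x, x ∉ Metric.cthickening δ (tsupport g) → fderiv ℝ f x = 0 := by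
    intro f hf x hx
    exact fderiv_of_notMem_tsupport ℝ fun h => hx (hf h)
  have hgK := Metric.self_subset_cthickening (δ := δ) (tsupport g)
  have key : ∀ ε > 0, |∫ x in Ω, fderiv ℝ g x (V x) ∂μ| ≤ ε * max M 0 := by
    intro ε hε
    obtain ⟨f, hf, hfK, hfe⟩ := aux_moll g hg hgc δ hδ ε hε
    have hf1 : ContDiff ℝ 1 f := hf.of_le (by exact_mod_cast le_top)
    have h0 := hsm f hf (hK'.of_isClosed_subset (isClosed_tsupport f) hfK) (hfK.trans hδΩ)
    have hsub : ∫ x in Ω, (fderiv ℝ f x (V x) - fderiv ℝ g x (V x)) ∂μ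
        = ∫ x in Ω, fderiv ℝ f x (V x) ∂μ - ∫ x in Ω, fderiv ℝ g x (V x) ∂μ :=
      integral_sub
        (aux_int hΩopen hK' hδΩ (hcont f hf1) (fun x hx => by simp [hzero f hfK x hx]) μ)
        (aux_int hΩopen hK' hδΩ (hcont g hg) (fun x hx => by simp [hzero g hgK x hx]) μ)
    have hb : |∫ x in Ω, (fderiv ℝ f x (V x) - fderiv ℝ g x (V x)) ∂μ| ≤ ε * max M 0 := by
      refine aux_abs (by positivity) (fun x => ?_) μ
      by_cases hx : x ∈ Metric.cthickening δ (tsupport g)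
      · rw [← sub_apply, ← Real.norm_eq_abs]
        refine (ContinuousLinearMap.le_opNorm _ _).trans ?_
        exact mul_le_mul (hfe x) ((hM x hx).trans (le_max_left _ _)) (norm_nonneg _) hε.le
      · rw [hzero f hfK x hx, hzero g hgK x hx]
        simp only [zero_apply, sub_zero, abs_zero]
        positivity
    rw [hsub, h0, zero_sub, abs_neg] at hb
    exact hb
  by_contra hne
  have hpos := abs_pos.2 hne
  set I := |∫ x in Ω, fderiv ℝ g x (V x) ∂μ|
  have hm : 0 ≤ max M 0 := le_max_right _ _
  have := key (I / (2 * (max M 0 + 1))) (by positivity)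
  rw [div_mul_eq_mul_div, le_div_iff₀ (by positivity)] at this
  nlinarith

open scoped Manifold in
theorem aux_cut {n : ℕ} {Ω K : Set (En n)} (hΩ : IsOpen Ω) (hK : IsCompact K) (hKΩ : K ⊆ Ω)
    (U : En n → ℝ) (hU : ContDiffOn ℝ 1 U Ω) :
    ∃ g : En n → ℝ, ContDiff ℝ 1 g ∧ HasCompactSupport g ∧ tsupport g ⊆ Ω ∧
      ∀ x ∈ K, fderiv ℝ g x = fderiv ℝ U x := by
  obtain ⟨δ, hδ, hδΩ⟩ := hK.exists_cthickening_subset_open hΩ hKΩ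
  have hK' : IsCompact (Metric.cthickening δ K) := hK.cthickening
  obtain ⟨χ, h1, h0, -⟩ := exists_contMDiffMap_one_nhds_of_subset_interior (n := 1) 𝓘(ℝ, En n)
    hK.isClosed ((Metric.self_subset_thickening hδ K).trans
      (Metric.thickening_subset_interior_cthickening δ K))
  have hχ : ContDiff ℝ 1 χ := χ.contMDiff.contDiff
  have hts : tsupport (fun x => χ x * U x) ⊆ Metric.cthickening δ K := by
    refine closure_minimal ?_ Metric.isClosed_cthickening
    intro x hx
    by_contra hxK
    exact hx (by simp [h0 x hxK])
  refine ⟨fun x => χ x * U x, ?_, hK'.of_isClosed_subset (isClosed_tsupport _) hts,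
    hts.trans hδΩ, ?_⟩
  · rw [contDiff_iff_contDiffAt]
    intro x
    by_cases hx : x ∈ Ω
    · exact hχ.contDiffAt.mul (hU.contDiffAt (hΩ.mem_nhds hx))
    · have hev : (fun x => χ x * U x) =ᶠ[𝓝 x] fun _ => 0 := by
        filter_upwards [Metric.isClosed_cthickening.isOpen_compl.mem_nhds
          (fun h => hx (hδΩ h))] with y hy
        rw [h0 y hy, zero_mul]
      exact contDiffAt_const.congr_of_eventuallyEq hev
  · intro x hx
    refine Filter.EventuallyEq.fderiv_eq ?_
    filter_upwards [eventually_nhdsSet_iff_forall.1 h1 x hx] with y hy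
    rw [hy, one_mul]

theorem aux_supp {n : ℕ} (μ : Measure (En n)) : ∀ᵐ x ∂μ, x ∈ measSupp μ := by
  rw [ae_iff]
  refine measure_null_of_locally_null _ fun x hx => ?_
  simp only [measSupp, mem_ofPred_eq, not_forall, not_lt, nonpos_iff_eq_zero] at hx
  obtain ⟨s, hs, hxs, h0⟩ := hx
  exact ⟨s, mem_nhdsWithin_of_mem_nhds (hs.mem_nhds hxs), h0⟩

/-- Let `Ω ⊆ 𝒰` be a connected open set and `U` a `C¹` compact function on
`Ω` with `V·∇U ≤ 0` on all of `Ω` (entire weak Lyapunov function) or `V·∇U ≥ 0` on all of `Ω`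
(entire weak anti-Lyapunov function). Let `(A_k)` be a null sequence of diffusion matrices,
`μ_k` stationary for `ℒ_{A_k}` on `Ω`, and `μ_k → μ` weak* with `μ` having compact support
contained in `Ω`. Then `supp μ ⊆ {x ∈ Ω : V(x)·∇U(x) = 0}`. -/
theorem stmt5 {n : ℕ} (hn : 1 ≤ n) (𝒰 Ω : Set (En n))
    (h𝒰open : IsOpen 𝒰) (h𝒰conn : IsConnected 𝒰)
    (V : En n → En n) (hV : ContinuousOn V 𝒰)
    (hΩopen : IsOpen Ω) (hΩconn : IsConnected Ω) (hΩ𝒰 : Ω ⊆ 𝒰)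
    (U : En n → ℝ) (hU : ContDiffOn ℝ 1 U Ω) (hUcf : IsCompactFunctionOn U Ω)
    (hLyap : (∀ x ∈ Ω, fderiv ℝ U x (V x) ≤ 0) ∨ (∀ x ∈ Ω, 0 ≤ fderiv ℝ U x (V x)))
    (A : ℕ → En n → Matrix (Fin n) (Fin n) ℝ) (hA : IsNullSeq 𝒰 A)
    (μs : ℕ → Measure (En n)) (hμs : ∀ k, IsStationaryMeasure (A k) V Ω (μs k))
    (μ : Measure (En n)) (hμ : IsProbOn Ω μ) (hlim : WeakStarLimOn Ω μs μ)
    (hsupp : IsCompact (measSupp μ) ∧ measSupp μ ⊆ Ω) :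
    measSupp μ ⊆ {x ∈ Ω | fderiv ℝ U x (V x) = 0} := by
  have := hμ.1
  obtain ⟨hK, hKΩ⟩ := hsupp
  obtain ⟨g, hg, hgc, hgΩ, hgK⟩ := aux_cut hΩopen hK hKΩ U hU
  have hI := aux_C1 𝒰 Ω V hV hΩopen hΩ𝒰 μ
    (aux_smooth 𝒰 Ω V hV hΩopen hΩ𝒰 A hA μs hμs μ hlim) g hg hgc hgΩ
  have hgcont : ContinuousOn (fun x => fderiv ℝ g x (V x)) Ω :=
    (hg.continuous_fderiv (by simp)).continuousOn.clm_apply (hV.mono hΩ𝒰)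
  have hint := aux_int hΩopen hgc hgΩ hgcont
    (fun x hx => by rw [fderiv_of_notMem_tsupport ℝ hx]; simp) μ
  have hres : μ.restrict Ω = μ :=
    Measure.restrict_eq_self_of_ae_mem (by rw [ae_iff]; exact hμ.2)
  rw [hres] at hint hI
  have hae := aux_supp μ
  have hz : ∀ᵐ x ∂μ, fderiv ℝ g x (V x) = 0 := by
    rcases hLyap with h | h
    · have h1 : 0 ≤ᵐ[μ] fun x => -(fderiv ℝ g x (V x)) := by
        filter_upwards [hae] with x hx
        simp only [Pi.zero_apply]
        rw [hgK x hx]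
        linarith [h x (hKΩ hx)]
      have h2 := (integral_eq_zero_iff_of_nonneg_ae h1 hint.neg).1
        (by rw [integral_neg, hI, neg_zero])
      filter_upwards [h2] with x hx
      simpa using hx
    · have h1 : 0 ≤ᵐ[μ] fun x => fderiv ℝ g x (V x) := by
        filter_upwards [hae] with x hx
        simp only [Pi.zero_apply]
        rw [hgK x hx]
        exact h x (hKΩ hx)
      exact (integral_eq_zero_iff_of_nonneg_ae h1 hint).1 hI
  intro x hx
  refine ⟨hKΩ hx, ?_⟩
  by_contra hne
  have hUc : ContinuousOn (fun x => fderiv ℝ U x (V x)) Ω :=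
    (hU.continuousOn_fderiv_of_isOpen hΩopen le_rfl).clm_apply (hV.mono hΩ𝒰)
  have hopen := hUc.isOpen_inter_preimage hΩopen (isOpen_compl_singleton (x := (0 : ℝ)))
  have hpos := hx _ hopen ⟨hKΩ hx, hne⟩
  refine hpos.ne' ?_
  refine measure_mono_null (t := {y | ¬ (fderiv ℝ g y (V y) = 0 ∧ y ∈ measSupp μ)}) ?_
    (ae_iff.1 (hz.and hae))
  rintro y ⟨-, hy⟩ ⟨h1, h2⟩
  rw [hgK y h2] at h1
  exact hy h1

end
end
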